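/- Let γ ∈ (0,2) and let M be an almost surely strictly positive random variable. Assume: (i) there exist C > 0 and ε₀ > 0 such that P(M ≤ ε) ≤ exp(−C ε^{−4/γ²}) for all ε ∈ (0, ε₀]; and (ii) E[|log(2M)|^q] < ∞ for some q > 1. For R > 0 define Z_R := E[∫_0^∞ c^{−1} exp(−R^{2+γ²/2} (c + c^{−1}) M) dc]. Then there exist f > 0 and R₀ > 0 such that −log Z_R ≥ f R² for all R ≥ R₀. -/

import Mathlib

open MeasureTheory

lemma aux_pt {a c : ℝ} (ha : 0 < a) (hc : 0 < c) :
    c⁻¹ * Real.exp (-(a * (c + c⁻¹))) ≤ Real.exp (-a) * (2 / a) * (1 + c ^ 2)⁻¹ := by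
  have hci : c * c⁻¹ = 1 := mul_inv_cancel₀ hc.ne'
  have hcp : 0 < c⁻¹ := inv_pos.mpr hc
  have hy : 2 ≤ c + c⁻¹ := by nlinarith [sq_nonneg (c - c⁻¹), sq_nonneg (c + c⁻¹)]
  set y := c + c⁻¹ with hyd
  have hyp : 0 < y := by linarith
  have h1 : Real.exp (-(a * y)) ≤ Real.exp (-a) * Real.exp (-(a * y / 2)) := by
    rw [← Real.exp_add]
    apply Real.exp_le_exp.mpr
    nlinarith
  have h2 : Real.exp (-(a * y / 2)) ≤ (a * y / 2)⁻¹ := by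
    rw [Real.exp_neg]
    apply inv_anti₀ (by positivity)
    linarith [Real.add_one_le_exp (a * y / 2)]
  calc c⁻¹ * Real.exp (-(a * y)) ≤ c⁻¹ * (Real.exp (-a) * (a * y / 2)⁻¹) := by
        gcongr
        exact h1.trans (by gcongr)
    _ = Real.exp (-a) * (2 / a) * (1 + c ^ 2)⁻¹ := by
        have : c * y = 1 + c ^ 2 := by rw [hyd]; field_simp; ring
        rw [← this]
        field_simp

lemma aux_int {a : ℝ} (ha : 0 < a) :
    IntegrableOn (fun c : ℝ => c⁻¹ * Real.exp (-(a * (c + c⁻¹)))) (Set.Ioi 0) := by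
  have hI : IntegrableOn (fun c : ℝ => Real.exp (-a) * (2 / a) * (1 + c ^ 2)⁻¹) (Set.Ioi 0) :=
    (integrable_inv_one_add_sq.const_mul _).integrableOn
  refine Integrable.mono' hI (Measurable.aestronglyMeasurable (by fun_prop)) ?_
  filter_upwards [ae_restrict_mem measurableSet_Ioi] with c hc
  have hc' : 0 < c := hc
  rw [Real.norm_of_nonneg (by positivity)]
  exact aux_pt ha hc'

lemma aux_le {a : ℝ} (ha : 0 < a) :
    ∫ c in Set.Ioi (0 : ℝ), c⁻¹ * Real.exp (-(a * (c + c⁻¹))) ≤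
      2 * Real.pi * (Real.exp (-a) * a⁻¹) := by
  have hI : Integrable (fun c : ℝ => Real.exp (-a) * (2 / a) * (1 + c ^ 2)⁻¹) :=
    integrable_inv_one_add_sq.const_mul _
  calc _ ≤ ∫ c in Set.Ioi (0 : ℝ), Real.exp (-a) * (2 / a) * (1 + c ^ 2)⁻¹ := by
        apply setIntegral_mono_on (aux_int ha) hI.integrableOn measurableSet_Ioi
        intro c hc
        exact aux_pt ha hc
    _ ≤ ∫ c : ℝ, Real.exp (-a) * (2 / a) * (1 + c ^ 2)⁻¹ := by
        apply setIntegral_le_integral hI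
        filter_upwards with c
        simp only [Pi.zero_apply]
        positivity
    _ = _ := by
        rw [integral_const_mul, integral_univ_inv_one_add_sq]
        field_simp

lemma aux_pos {a : ℝ} (ha : 0 < a) :
    0 < ∫ c in Set.Ioi (0 : ℝ), c⁻¹ * Real.exp (-(a * (c + c⁻¹))) := by
  rw [setIntegral_pos_iff_support_of_nonneg_ae _ (aux_int ha)]
  · have : Function.support (fun c : ℝ => c⁻¹ * Real.exp (-(a * (c + c⁻¹)))) ∩ Set.Ioi 0
        = Set.Ioi 0 := by
      apply Set.inter_eq_right.mpr
      intro c hc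
      have hc' : 0 < c := hc
      simp only [Function.mem_support]
      positivity
    rw [this]
    simp
  · filter_upwards [ae_restrict_mem measurableSet_Ioi] with c hc
    have hc' : 0 < c := hc
    simp only [Pi.zero_apply]
    positivity

lemma aux_tail {C α t : ℝ} (hC : 0 < C) (hα : 1 < α) (ht : 1 ≤ t) :
    Real.exp (-C * (t ^ (-(1 / 2) : ℝ)) ^ (-α)) ≤ (24 / C ^ 4) * t ^ (-2 : ℝ) := by
  have ht0 : 0 < t := by linarith
  rw [← Real.rpow_mul ht0.le]
  have h1 : t ^ (1 / 2 : ℝ) ≤ t ^ (-(1 / 2) * -α : ℝ) :=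
    Real.rpow_le_rpow_of_exponent_le ht (by linarith)
  set x := t ^ (1 / 2 : ℝ) with hx
  have hxp : 0 < x := by positivity
  have hx4 : t ^ (-2 : ℝ) = (x ^ 4)⁻¹ := by
    rw [Real.rpow_neg ht0.le, hx, ← Real.rpow_natCast, ← Real.rpow_mul ht0.le]
    norm_num
  have h2 := Real.pow_div_factorial_le_exp (C * x) (by positivity) 4
  calc Real.exp (-C * t ^ (-(1 / 2) * -α : ℝ)) ≤ Real.exp (-(C * x)) := by
        apply Real.exp_le_exp.mpr
        nlinarith
    _ ≤ ((C * x) ^ 4 / (Nat.factorial 4))⁻¹ := by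
        rw [Real.exp_neg]
        exact inv_anti₀ (by positivity) h2
    _ = _ := by
        rw [hx4]
        simp [Nat.factorial]
        field_simp

lemma aux_mom {Ω : Type*} [MeasurableSpace Ω] (μ : Measure Ω) [IsProbabilityMeasure μ]
    (α : ℝ) (hα : 1 < α)
    (M : Ω → ℝ) (hMmeas : Measurable M) (hMpos : ∀ᵐ ω ∂μ, 0 < M ω)
    (C ε₀ : ℝ) (hC : 0 < C) (hε₀ : 0 < ε₀)
    (hSD : ∀ ε : ℝ, 0 < ε → ε ≤ ε₀ →
      (μ {ω | M ω ≤ ε}).toReal ≤ Real.exp (-C * ε ^ (-α : ℝ))) :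
    Integrable (fun ω => (M ω ^ 2)⁻¹) μ := by
  have hm : Measurable (fun ω => (M ω ^ 2)⁻¹) := by fun_prop
  refine ⟨hm.aestronglyMeasurable, ?_⟩
  rw [hasFiniteIntegral_iff_ofReal (Filter.Eventually.of_forall fun ω => by positivity)]
  rw [lintegral_eq_lintegral_meas_lt μ (Filter.Eventually.of_forall fun ω => by positivity)
    hm.aemeasurable]
  set T : ℝ := max 1 (ε₀⁻¹ ^ 2) with hT
  have hT1 : 1 ≤ T := le_max_left _ _
  have hsub : Set.Ioi (0 : ℝ) ⊆ Set.Ioc 0 T ∪ Set.Ioi T := by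
    rw [Set.Ioc_union_Ioi_eq_Ioi (by linarith)]
  refine (lintegral_mono_set hsub).trans_lt ((lintegral_union_le _ _ _).trans_lt ?_)
  refine ENNReal.add_lt_top.mpr ⟨?_, ?_⟩
  · calc _ ≤ ∫⁻ t in Set.Ioc 0 T, (1 : ENNReal) := lintegral_mono fun t => prob_le_one
      _ < ⊤ := by simp
  · have hI : IntegrableOn (fun t : ℝ => (24 / C ^ 4) * t ^ (-2 : ℝ)) (Set.Ioi T) :=
      (integrableOn_Ioi_rpow_of_lt (by norm_num) (by linarith)).const_mul _
    refine lt_of_le_of_lt ?_ hI.lintegral_lt_top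
    apply setLIntegral_mono' measurableSet_Ioi
    intro t ht
    have ht' : T < t := ht
    have ht1 : 1 ≤ t := by linarith
    have ht0 : 0 < t := by linarith
    set e : ℝ := t ^ (-(1 / 2) : ℝ) with he
    have hep : 0 < e := by positivity
    have hes : (e ^ 2)⁻¹ = t := by
      rw [he, ← Real.rpow_natCast, ← Real.rpow_mul ht0.le]
      norm_num
      rw [Real.rpow_neg_one, inv_inv]
    have hee : e ≤ ε₀ := by
      by_contra! h
      have h3 : ε₀⁻¹ ^ 2 ≤ T := le_max_right _ _
      have h4 : (e ^ 2)⁻¹ ≤ (ε₀ ^ 2)⁻¹ := by gcongr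
      rw [inv_pow] at h3
      linarith
    have h5 := (hSD e hep hee).trans (aux_tail hC hα ht1)
    have h6 : μ {ω | t < (M ω ^ 2)⁻¹} ≤ μ {ω | M ω ≤ e} := by
      apply measure_mono_ae
      filter_upwards [hMpos] with ω hω hlt
      have hlt' : t < (M ω ^ 2)⁻¹ := hlt
      change M ω ≤ e
      by_contra! h
      have : (M ω ^ 2)⁻¹ ≤ (e ^ 2)⁻¹ := by gcongr
      linarith
    refine h6.trans ?_
    rw [← ENNReal.ofReal_toReal (measure_ne_top μ {ω | M ω ≤ e})]
    exact ENNReal.ofReal_le_ofReal h5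

set_option maxHeartbeats 1600000 in
/-- Let `γ ∈ (0,2)` and `M > 0` a.s. Assume the small-deviation bound
`P(M ≤ ε) ≤ exp(−Cε^{−4/γ²})` for small `ε`, and `E[|log(2M)|^q] < ∞` for some `q > 1`.
With `Z_R := E[∫_0^∞ c⁻¹ exp(−R^{2+γ²/2}(c+c⁻¹)M) dc]`, there are `f > 0` and `R₀ > 0`
with `−log Z_R ≥ f R²` for all `R ≥ R₀`. -/
theorem stmt16 {Ω : Type*} [MeasurableSpace Ω] (μ : Measure Ω) [IsProbabilityMeasure μ]
    (γ : ℝ) (hγ0 : 0 < γ) (hγ2 : γ < 2)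
    (M : Ω → ℝ) (hMmeas : Measurable M) (hMpos : ∀ᵐ ω ∂μ, 0 < M ω)
    (C ε₀ : ℝ) (hC : 0 < C) (hε₀ : 0 < ε₀)
    (hSD : ∀ ε : ℝ, 0 < ε → ε ≤ ε₀ →
      (μ {ω | M ω ≤ ε}).toReal ≤ Real.exp (-C * ε ^ (-(4 / γ ^ 2) : ℝ)))
    (q : ℝ) (hq : 1 < q)
    (hlog : Integrable (fun ω => |Real.log (2 * M ω)| ^ q) μ) :
    ∃ f > (0 : ℝ), ∃ R₀ > (0 : ℝ), ∀ R : ℝ, R₀ ≤ R →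
      f * R ^ 2 ≤
        -Real.log (∫ ω, (∫ c in Set.Ioi (0 : ℝ),
          c⁻¹ * Real.exp (-(R ^ (2 + γ ^ 2 / 2 : ℝ)) * (c + c⁻¹) * M ω)) ∂μ) := by
  have hg2 : 0 < γ ^ 2 := by positivity
  have hα : 1 < 4 / γ ^ 2 := by
    rw [lt_div_iff₀ hg2]; nlinarith
  have hN := aux_mom μ (4 / γ ^ 2) hα M hMmeas hMpos C ε₀ hC hε₀ hSD
  set N := ∫ ω, (M ω ^ 2)⁻¹ ∂μ with hNd
  have hN0 : 0 ≤ N := integral_nonneg fun ω => by positivity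
  set f₀ : ℝ := min 1 (C / 2) with hf₀
  have hf₀p : 0 < f₀ := lt_min one_pos (by positivity)
  set K : ℝ := 2 * Real.pi * (2 + 2 * N) with hK
  have hKp : 0 < K := by have := Real.pi_pos; positivity
  have hev1 : ∀ᶠ R : ℝ in Filter.atTop, R ^ (-(γ ^ 2 / 2) : ℝ) < ε₀ :=
    (tendsto_rpow_neg_atTop (by positivity : 0 < γ ^ 2 / 2)).eventually_lt_const hε₀
  have hev2 : ∀ᶠ R : ℝ in Filter.atTop, Real.log K / (f₀ / 2) ≤ R ^ 2 :=
    (Filter.tendsto_pow_atTop (by norm_num : (2 : ℕ) ≠ 0)).eventually_ge_atTop _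
  obtain ⟨R₁, hR₁⟩ := Filter.eventually_atTop.mp (hev1.and hev2)
  refine ⟨f₀ / 2, by positivity, max 1 R₁, by positivity, ?_⟩
  intro R hR
  have hR1 : 1 ≤ R := (le_max_left _ _).trans hR
  have hR0 : 0 < R := by linarith
  obtain ⟨hε, hlogK⟩ := hR₁ R ((le_max_right _ _).trans hR)
  set ε : ℝ := R ^ (-(γ ^ 2 / 2) : ℝ) with hεd
  have hεp : 0 < ε := by positivity
  set L : ℝ := R ^ (2 + γ ^ 2 / 2 : ℝ) with hL
  have hL1 : 1 ≤ L := Real.one_le_rpow hR1 (by positivity)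
  have hLp : 0 < L := by linarith
  have hLε : L * ε = R ^ 2 := by
    rw [hL, hεd, ← Real.rpow_add hR0, ← Real.rpow_natCast R 2]
    congr 1
    push_cast
    ring
  have hεα : ε ^ (-(4 / γ ^ 2) : ℝ) = R ^ 2 := by
    rw [hεd, ← Real.rpow_mul hR0.le, ← Real.rpow_natCast R 2]
    congr 1
    push_cast
    field_simp
    norm_num
  have hP := hSD ε hεp hε.le
  rw [hεα] at hP
  set A : Set Ω := {ω | M ω ≤ ε} with hA
  have hAm : MeasurableSet A := measurableSet_le hMmeas measurable_const
  have hform : ∀ (ω : Ω) (c : ℝ), c⁻¹ * Real.exp (-L * (c + c⁻¹) * M ω) =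
      c⁻¹ * Real.exp (-((L * M ω) * (c + c⁻¹))) := by
    intro ω c
    congr 2
    ring
  simp only [hform]
  set F : Ω → ℝ := fun ω => ∫ c in Set.Ioi (0 : ℝ),
    c⁻¹ * Real.exp (-((L * M ω) * (c + c⁻¹))) with hF
  set s : ℝ := Real.exp (-(C / 2 * R ^ 2)) with hs
  have hsp : 0 < s := Real.exp_pos _
  set D : Ω → ℝ := fun ω => 2 * Real.pi * ((Real.exp (-R ^ 2) * (1 + (M ω ^ 2)⁻¹)
    + s * (M ω ^ 2)⁻¹) + s⁻¹ * A.indicator (fun _ => (1 : ℝ)) ω) with hD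
  have hI12 : Integrable (fun ω => Real.exp (-R ^ 2) * (1 + (M ω ^ 2)⁻¹) + s * (M ω ^ 2)⁻¹) μ :=
    (((integrable_const _).add hN).const_mul _).add (hN.const_mul _)
  have hI1 : Integrable (fun ω => Real.exp (-R ^ 2) * (1 + (M ω ^ 2)⁻¹)) μ :=
    ((integrable_const _).add hN).const_mul _
  have hI2 : Integrable (fun ω => s * (M ω ^ 2)⁻¹) μ := hN.const_mul _
  have hI3 : Integrable (fun ω => s⁻¹ * A.indicator (fun _ => (1 : ℝ)) ω) μ :=
    ((integrable_const (1 : ℝ)).indicator hAm).const_mul _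
  have hDint : Integrable D μ := ((hI1.add hI2).add hI3).const_mul _
  have hFpos : ∀ᵐ ω ∂μ, 0 < F ω := by
    filter_upwards [hMpos] with ω hω
    exact aux_pos (by positivity)
  have hFD : ∀ᵐ ω ∂μ, F ω ≤ D ω := by
    filter_upwards [hMpos] with ω hω
    refine (aux_le (by positivity : 0 < L * M ω)).trans ?_
    have hpi := Real.pi_pos
    simp only [hD]
    refine mul_le_mul_of_nonneg_left ?_ (by positivity)
    have hm : 0 < (M ω)⁻¹ := inv_pos.mpr hω
    have hinv : (L * M ω)⁻¹ ≤ (M ω)⁻¹ := inv_anti₀ hω (by nlinarith)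
    rw [← inv_pow]
    set m := (M ω)⁻¹ with hmd
    have hE := Real.exp_pos (-R ^ 2)
    have hsi : 0 < s⁻¹ := inv_pos.mpr hsp
    by_cases h : ω ∈ A
    · rw [Set.indicator_of_mem h]
      have h1 : Real.exp (-(L * M ω)) ≤ 1 := Real.exp_le_one_iff.mpr (by
        have : 0 < L * M ω := by positivity
        linarith)
      have h2 : Real.exp (-(L * M ω)) * (L * M ω)⁻¹ ≤ 1 * m := by gcongr
      have h3 : m ≤ s * m ^ 2 + s⁻¹ := by
        have : s * s⁻¹ = 1 := mul_inv_cancel₀ hsp.ne'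
        have h4 : 0 ≤ s * (m - s⁻¹) ^ 2 := by positivity
        have h5 : s * (m - s⁻¹) ^ 2 = s * m ^ 2 - 2 * m * (s * s⁻¹) + s⁻¹ * (s * s⁻¹) := by ring
        rw [h5, this] at h4
        linarith
      have h6 : 0 ≤ Real.exp (-R ^ 2) * (1 + m ^ 2) := by positivity
      linarith
    · rw [Set.indicator_of_notMem h]
      have hlt : ε < M ω := not_le.mp h
      have h1 : Real.exp (-(L * M ω)) ≤ Real.exp (-R ^ 2) := by
        apply Real.exp_le_exp.mpr
        rw [← hLε]
        nlinarith
      have h2 : Real.exp (-(L * M ω)) * (L * M ω)⁻¹ ≤ Real.exp (-R ^ 2) * (1 + m ^ 2) := by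
        have : (L * M ω)⁻¹ ≤ 1 + m ^ 2 := by nlinarith [sq_nonneg (m - 1)]
        gcongr
      have h6 : 0 ≤ s * m ^ 2 := by positivity
      linarith
  have hFm : AEStronglyMeasurable F μ := by
    have : StronglyMeasurable F := by
      apply StronglyMeasurable.integral_prod_right' (ν := volume.restrict (Set.Ioi (0 : ℝ)))
        (f := fun p : Ω × ℝ => p.2⁻¹ * Real.exp (-((L * M p.1) * (p.2 + p.2⁻¹))))
      apply Measurable.stronglyMeasurable
      fun_prop
    exact this.aestronglyMeasurable
  have hFint : Integrable F μ := by
    refine Integrable.mono' hDint hFm ?_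
    filter_upwards [hFpos, hFD] with ω h1 h2
    rwa [Real.norm_of_nonneg h1.le]
  have hZpos : 0 < ∫ ω, F ω ∂μ := by
    rw [integral_pos_iff_support_of_nonneg_ae (hFpos.mono fun ω h => h.le) hFint]
    have : μ (Function.support F) = 1 := by
      rw [prob_compl_eq_zero_iff₀ ?_ |>.symm]
      · have h : ∀ᵐ ω ∂μ, ω ∈ Function.support F := hFpos.mono fun ω h => h.ne'
        exact h
      · exact hFm.aemeasurable.nullMeasurable (measurableSet_singleton (0 : ℝ)).compl
    rw [this]
    exact one_pos
  have hDval : ∫ ω, D ω ∂μ = 2 * Real.pi * ((Real.exp (-R ^ 2) * (1 + N) + s * N)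
      + s⁻¹ * (μ A).toReal) := by
    simp only [hD]
    rw [integral_const_mul, integral_add hI12 hI3, integral_add hI1 hI2,
      integral_const_mul, integral_const_mul, integral_const_mul,
      integral_add (integrable_const _) hN, integral_indicator_const _ hAm]
    simp [Measure.real, hNd]
  have hZle : ∫ ω, F ω ∂μ ≤ K * Real.exp (-(f₀ * R ^ 2)) := by
    refine (integral_mono_ae hFint hDint hFD).trans ?_
    rw [hDval, hK, mul_assoc (2 * Real.pi)]
    have hpi := Real.pi_pos
    refine mul_le_mul_of_nonneg_left ?_ (by positivity)
    set E := Real.exp (-(f₀ * R ^ 2)) with hE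
    have hR2 : 0 ≤ R ^ 2 := by positivity
    have e1 : Real.exp (-R ^ 2) ≤ E := by
      apply Real.exp_le_exp.mpr
      nlinarith [min_le_left 1 (C / 2)]
    have e2 : s ≤ E := by
      apply Real.exp_le_exp.mpr
      nlinarith [min_le_right 1 (C / 2)]
    have e3 : s⁻¹ * (μ A).toReal ≤ s := by
      calc s⁻¹ * (μ A).toReal ≤ s⁻¹ * Real.exp (-C * R ^ 2) := by gcongr
        _ = s := by
          rw [hs, ← Real.exp_neg, ← Real.exp_add]
          congr 1
          ring
    have e4 : Real.exp (-R ^ 2) * (1 + N) ≤ E * (1 + N) := by gcongr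
    have e5 : s * N ≤ E * N := by gcongr
    linarith
  have hlogZ := Real.log_le_log hZpos hZle
  rw [Real.log_mul hKp.ne' (Real.exp_pos _).ne', Real.log_exp] at hlogZ
  rw [div_le_iff₀ (by positivity)] at hlogK
  linarith
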